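/- Let (Δ,Θ) be a directive bi-sequence with associated prefixes (w_n), let n ≥ 0, suppose Assumption A holds for (w_n, w_{n+1}), and suppose exactly two pseudopalindromic prefixes v₁, v₂ with |v₁| < |v₂| are missed between w_n and w_{n+1}. Then there exist pairwise distinct i, j, k ∈ {0,1,2} such that w_n is an E_i-palindrome, v₁ is an E_j-palindrome, v₂ is an E_k-palindrome, and w_{n+1} is an E_i-palindrome. -/

import Mathlib

/-- The ternary alphabet. -/
abbrev Letter := Fin 3

/-- Finite words over the ternary alphabet. -/
abbrev Word := List Letter

/-- The four involutory antimorphisms of ternary words: the reversal `R`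
and, for each letter `i`, the antimorphism `E i`. -/
inductive AM where
  | R : AM
  | E : Letter → AM
deriving DecidableEq

/-- The action of an antimorphism on a single letter: `R` fixes every letter,
and `E i` fixes `i` and exchanges the other two letters (in `Fin 3`,
this involution is `a ↦ -(i + a)`). -/
def AM.letter : AM → Letter → Letter
  | .R, _a => _a
  | .E i, a => -(i + a)

/-- The action of an antimorphism on a word: letterwise image followed by reversal. -/
def AM.apply (t : AM) (w : Word) : Word := (w.map t.letter).reverse

/-- A word is a pseudopalindrome if it is a `ϑ`-palindrome for some
`ϑ ∈ {R, E_0, E_1, E_2}`. -/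
def IsPseudopal (w : Word) : Prop := ∃ t : AM, t.apply w = w

/-- `v` is an image of `w` if `v = ϑ(w)` for some `ϑ ∈ {R, E_0, E_1, E_2}`. -/
def IsImage (w v : Word) : Prop := ∃ t : AM, v = t.apply w

/-- `v` is the `ϑ`-palindromic closure of `u`: the shortest `ϑ`-palindrome
having `u` as a prefix. -/
def IsPalClosure (t : AM) (u v : Word) : Prop :=
  u <+: v ∧ t.apply v = v ∧
    ∀ v' : Word, u <+: v' → t.apply v' = v' → v.length ≤ v'.length

/-- `w` is the sequence of prefixes associated with the directive bi-sequence
`(Δ, Θ)`: `w 0 = ε` and `w (n+1) = (w n · δ_{n+1})^{ϑ_{n+1}}`. -/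
def DirectivePrefixes (Δ : ℕ → Letter) (Θ : ℕ → AM) (w : ℕ → Word) : Prop :=
  w 0 = [] ∧ ∀ n : ℕ, IsPalClosure (Θ (n + 1)) (w n ++ [Δ (n + 1)]) (w (n + 1))

/-- A pseudopalindromic prefix `v` of `w_{n+1}` is missed between `w_n` and `w_{n+1}`
if `|w_n| < |v| < |w_{n+1}|`. -/
def MissedBetween (wn wn1 v : Word) : Prop :=
  v <+: wn1 ∧ IsPseudopal v ∧ wn.length < v.length ∧ v.length < wn1.length

/-- An image of `u` occurs in `v` at (0-indexed) position `p`. -/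
def OccursImageAt (u v : Word) (p : ℕ) : Prop :=
  p + u.length ≤ v.length ∧ IsImage u ((v.drop p).take u.length)

/-- Assumption A for the pair `(wn, wn1)`: some image of `wn` occurs in `wn1`
at a position `p` with `0 < p < |wn1| - |wn|`, overlapping both the prefix
occurrence of `wn` and the suffix occurrence of an image of `wn`. -/
def AssumptionA (wn wn1 : Word) : Prop :=
  ∃ p : ℕ, 0 < p ∧ p < wn1.length - wn.length ∧ p < wn.length ∧
    wn1.length - wn.length < p + wn.length ∧ OccursImageAt wn wn1 p

/-- The prefix of length `n` of the directive bi-sequence is normalized: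
every pseudopalindromic prefix of `w n` equals `w k` for some `k ≤ n`. -/
def NormalizedUpTo (w : ℕ → Word) (n : ℕ) : Prop :=
  ∀ v : Word, v <+: w n → IsPseudopal v → ∃ k : ℕ, k ≤ n ∧ v = w k

/-- `rep u l` is the `l`-fold concatenation `u^l`. -/
def rep (u : Word) (l : ℕ) : Word := (List.replicate l u).flatten

/-- `rmSuf x y` is `x · y⁻¹`: the word `x` with its suffix of length `|y|` removed. -/
def rmSuf (x y : Word) : Word := x.take (x.length - y.length)

/-- `v` is a prefix of the infinite periodic word `pat^ω`. -/
def IsPrefixOfPow (pat v : Word) : Prop :=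
  ∀ q : ℕ, ∀ hq : q < v.length, ∃ hp : q % pat.length < pat.length,
    v.get ⟨q, hq⟩ = pat.get ⟨q % pat.length, hp⟩
theorem AM.forall_iff {P : AM → Prop} : (∀ t, P t) ↔ P .R ∧ ∀ i, P (.E i) :=
  ⟨fun h => ⟨h _, fun _ => h _⟩, fun h t => by cases t with
    | R => exact h.1
    | E i => exact h.2 i⟩

theorem AM.exists_iff {P : AM → Prop} : (∃ t, P t) ↔ P .R ∨ ∃ i, P (.E i) := by
  constructor
  · rintro ⟨t, ht⟩
    cases t with
    | R => exact .inl ht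
    | E i => exact .inr ⟨i, ht⟩
  · rintro (h | ⟨i, h⟩)
    exacts [⟨_, h⟩, ⟨_, h⟩]

instance AM.decidableForall (P : AM → Prop) [DecidablePred P] : Decidable (∀ t, P t) :=
  decidable_of_iff _ AM.forall_iff.symm

instance AM.decidableExists (P : AM → Prop) [DecidablePred P] : Decidable (∃ t, P t) :=
  decidable_of_iff _ AM.exists_iff.symm

@[simp] theorem AM.letter_letter (t : AM) (a : Letter) : t.letter (t.letter a) = a := by
  cases t <;> simp [AM.letter]

theorem AM.letter_injective (t : AM) : Function.Injective t.letter :=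
  Function.LeftInverse.injective t.letter_letter

theorem AM.letter_comp_injective (s t : AM) : Function.Injective fun a => s.letter (t.letter a) :=
  s.letter_injective.comp t.letter_injective

/-- Injective self-maps of a three-letter alphabet that agree on two letters are equal. -/
theorem eq_of_injective_of_eq_of_eq {g h : Letter → Letter} (hg : Function.Injective g)
    (hh : Function.Injective h) {x y : Letter} (hxy : x ≠ y) (hx : g x = h x) (hy : g y = h y)
    (a : Letter) : g a = h a := by
  by_cases hax : a = x
  · rw [hax, hx]
  by_cases hay : a = y
  · rw [hay, hy]
  have h1 := hg.ne hax
  have h2 := hg.ne hay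
  have h3 := hg.ne hxy
  have h4 := hh.ne hax
  have h5 := hh.ne hay
  grind

/-- If the two ways of composing `s`, `t`, `u` agree at one letter, the product `s t u`
is again one of the four involutions. -/
theorem AM.exists_letter_eq_comp : ∀ (s t u : AM) (a : Letter),
    s.letter (u.letter a) = t.letter (u.letter (s.letter (t.letter a))) →
    ∃ v : AM, ∀ b, v.letter b = s.letter (t.letter (u.letter b)) := by
  decide

theorem AM.exists_letter_eq_of_powers : ∀ s t t' u : AM,
    (∀ a, t.letter (s.letter a) = t'.letter (t.letter a)) →
    (∀ a, u.letter (t'.letter a) = t.letter (s.letter (t.letter (s.letter a)))) →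
    ∃ v : AM, ∀ b, v.letter b = u.letter (t.letter (s.letter b)) := by
  decide

theorem AM.types_of_letter_eq : ∀ s t t' u : AM, t ≠ u → t' ≠ u → t ≠ t' →
    (∀ a, t.letter (s.letter a) = u.letter (t'.letter a)) →
    (∀ a, t'.letter (s.letter a) = u.letter (t.letter a)) →
    ∃ i j k : Letter, i ≠ j ∧ j ≠ k ∧ i ≠ k ∧ s = .E i ∧ t = .E j ∧ t' = .E k ∧ u = .E i := by
  decide

/-- The prefix of length `N` of the sequence `f` is a `t`-palindrome. -/
def PalPrefix (f : ℕ → Letter) (t : AM) (N : ℕ) : Prop :=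
  ∀ q r, q + r + 1 = N → f r = t.letter (f q)

namespace PalPrefix

variable {f : ℕ → Letter}

theorem congr_letter {s t : AM} {N : ℕ} (h : PalPrefix f s N)
    (hst : ∀ a, s.letter a = t.letter a) : PalPrefix f t N := fun q r hqr => by
  rw [h q r hqr, hst]

/-- Two palindromic prefixes give a shift by the difference of their lengths. -/
theorem shift {s t : AM} {N p : ℕ} (hs : PalPrefix f s N) (ht : PalPrefix f t (N + p)) {q : ℕ}
    (hq : q < N) : f (q + p) = t.letter (s.letter (f q)) := by
  rw [ht (N - 1 - q) (q + p) (by omega), hs q (N - 1 - q) (by omega)]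

/-- If an image of a prefix of length `m` occurs at position `p ≤ m`, the prefix ending with this
occurrence is a palindrome. -/
theorem of_occurrence {t : AM} {m p : ℕ} (hp : p ≤ m)
    (h : ∀ q r, q + r + 1 = m → f (p + r) = t.letter (f q)) : PalPrefix f t (m + p) := by
  intro q r hqr
  by_cases hr : p ≤ r
  · have := h q (r - p) (by omega)
    rwa [show p + (r - p) = r by omega] at this
  · have := h r (q - p) (by omega)
    rw [show p + (q - p) = q by omega] at this
    rw [this, AM.letter_letter]

theorem of_shift {s t : AM} {φ : Letter → Letter} {m p : ℕ} (hs : PalPrefix f s m) (hp : p ≤ m)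
    (h : ∀ q < m, f (q + p) = φ (f q)) (ht : ∀ a, t.letter a = φ (s.letter a)) :
    PalPrefix f t (m + p) :=
  of_occurrence hp fun q r hqr => by
    rw [add_comm p r, h r (by omega), hs q r hqr, ht]

/-- A reflected occurrence of an image of the prefix of length `m` yields a palindromic prefix. -/
theorem reflect {s t u : AM} {m p p' : ℕ} (hs : PalPrefix f s m) (ht : PalPrefix f t (m + p))
    (hu : PalPrefix f u (m + p + p')) (hp' : p' < m) : ∃ v, PalPrefix f v (m + p') := by
  have h1 := hs.shift ht (q := 0) (by omega)
  have h2 := ht.shift hu (q := 0 + p) (by omega)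
  have h3 := ht.shift hu (q := 0) (by omega)
  have h4 := hs.shift ht (q := 0 + p') (by omega)
  rw [h1] at h2
  rw [h3] at h4
  rw [add_right_comm, h4, AM.letter_letter] at h2
  obtain ⟨v, hv⟩ := AM.exists_letter_eq_comp u t s (f 0) h2.symm
  exact ⟨v, hs.of_shift (φ := fun a => u.letter (t.letter a)) hp'.le
    (fun q hq => ht.shift hu (by omega)) hv⟩

theorem exists_ne {s t u : AM} {m p p' : ℕ} (hs : PalPrefix f s m) (ht : PalPrefix f t (m + p))
    (hu : PalPrefix f u (m + p + p')) (hp0 : 0 < p) (hp : p < m) (hp0' : 0 < p') (hp' : p' < m)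
    (hmin : ∀ r, 0 < r → r < p + p' → ¬ PalPrefix f u (m + r)) :
    ∃ x < m, ∃ y < m, f x ≠ f y := by
  by_contra! hc
  have hw : ∀ q < m, f q = f 0 := fun q hq => hc q hq 0 (by omega)
  have e1 := hs.shift ht (q := 0) (by omega)
  rw [hw (0 + p) (by omega)] at e1
  have hv : ∀ q < m + p, f q = f 0 := by
    intro q hq
    by_cases hqm : q < m
    · exact hw q hqm
    · have := hs.shift ht (q := q - p) (by omega)
      rwa [show q - p + p = q by omega, hw (q - p) (by omega), ← e1] at this
  have e2 := ht.shift hu (q := 0) (by omega)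
  rw [hw (0 + p') (by omega)] at e2
  have hW : ∀ q < m + p + p', f q = f 0 := by
    intro q hq
    by_cases hqm : q < m + p
    · exact hv q hqm
    · have := ht.shift hu (q := q - p') (by omega)
      rwa [show q - p' + p' = q by omega, hv (q - p') (by omega), ← e2] at this
  have e3 := hu 0 (m + p + p' - 1) (by omega)
  rw [hW _ (by omega)] at e3
  refine hmin p hp0 (by omega) fun q r hqr => ?_
  rw [hv q (by omega), hv r (by omega), ← e3]

/-- Two compositions of involutions that agree along a nonconstant prefix are equal. -/
theorem _root_.AM.comp_eq_of_forall_lt {s t u v : AM} {m : ℕ}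
    (hne : ∃ x < m, ∃ y < m, f x ≠ f y)
    (h : ∀ q < m, s.letter (t.letter (f q)) = u.letter (v.letter (f q))) (a : Letter) :
    s.letter (t.letter a) = u.letter (v.letter a) := by
  obtain ⟨x, hx, y, hy, hxy⟩ := hne
  exact eq_of_injective_of_eq_of_eq (s.letter_comp_injective t) (u.letter_comp_injective v) hxy
    (h x hx) (h y hy) a

/-- The types of the palindromic prefixes when the two missed ones are placed symmetrically. -/
theorem types_of_symmetric {s t₁ t₂ u : AM} {m p₁ p₂ : ℕ} (hs : PalPrefix f s m)
    (h1 : PalPrefix f t₁ (m + p₁)) (h2 : PalPrefix f t₂ (m + p₂))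
    (hu : PalPrefix f u (m + (p₁ + p₂))) (hp1 : 0 < p₁) (hp12 : p₁ < p₂) (hp2 : p₂ < m)
    (hmin : ∀ r, 0 < r → r < p₁ + p₂ → ¬ PalPrefix f u (m + r))
    (hmiss : ∀ t r, 0 < r → r < p₁ + p₂ → PalPrefix f t (m + r) → r = p₁ ∨ r = p₂) :
    ∃ i j k : Letter, i ≠ j ∧ j ≠ k ∧ i ≠ k ∧ s = .E i ∧ t₁ = .E j ∧ t₂ = .E k ∧ u = .E i := by
  have hu1 : PalPrefix f u (m + p₁ + p₂) := by rwa [← add_assoc] at hu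
  have hu2 : PalPrefix f u (m + p₂ + p₁) := by rwa [add_comm p₁ p₂, ← add_assoc] at hu
  have hne := hs.exists_ne h1 hu1 hp1 (by omega) (by omega) hp2 hmin
  have c1 := AM.comp_eq_of_forall_lt (s := t₁) (t := s) (u := u) (v := t₂) hne fun q hq => by
    rw [← hs.shift h1 hq, h2.shift hu2 (by omega)]
  have c2 := AM.comp_eq_of_forall_lt (s := t₂) (t := s) (u := u) (v := t₁) hne fun q hq => by
    rw [← hs.shift h2 hq, h1.shift hu1 (by omega)]
  refine AM.types_of_letter_eq s t₁ t₂ u ?_ ?_ ?_ c1 c2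
  · rintro rfl
    exact hmin p₁ hp1 (by omega) h1
  · rintro rfl
    exact hmin p₂ (by omega) (by omega) h2
  · rintro rfl
    obtain ⟨d, rfl⟩ := Nat.exists_eq_add_of_lt hp12
    by_cases hd : d + 1 < p₁
    · have hsd : PalPrefix f s (m + (d + 1)) :=
        hs.of_shift (φ := id) (by omega) (fun q hq => by
          have h2' : PalPrefix f t₁ (m + p₁ + (d + 1)) := by
            rwa [add_assoc m p₁, ← add_assoc p₁ d 1]
          rw [h1.shift h2' (by omega), AM.letter_letter, id]) (fun _ => rfl)
      have := hmiss s (d + 1) (by omega) (by omega) hsd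
      omega
    · refine hmin (p₁ + p₁) (by omega) (by omega) ?_
      refine hs.of_shift (φ := fun a => u.letter (s.letter a)) (by omega) (fun q hq => ?_)
        (fun a => by simp)
      rw [← add_assoc, h2.shift hu2 (by omega), hs.shift h1 hq, AM.letter_letter]

/-- A palindromic prefix in the middle cannot be preceded by exactly one other without a third. -/
theorem false_of_middle {s t₁ t₂ u : AM} {m p₁ p₂ : ℕ} (hs : PalPrefix f s m)
    (h1 : PalPrefix f t₁ (m + p₁)) (h2 : PalPrefix f t₂ (m + p₂))
    (hu : PalPrefix f u (m + (p₂ + p₂))) (hp1 : 0 < p₁) (hp12 : p₁ < p₂) (hp2 : p₂ < m)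
    (hmin : ∀ r, 0 < r → r < p₂ + p₂ → ¬ PalPrefix f u (m + r))
    (hmiss : ∀ t r, 0 < r → r < p₂ + p₂ → PalPrefix f t (m + r) → r = p₁ ∨ r = p₂) : False := by
  have hu2 : PalPrefix f u (m + p₂ + p₂) := by rwa [← add_assoc] at hu
  have hne := hs.exists_ne h2 hu2 (by omega) hp2 (by omega) hp2 hmin
  obtain ⟨d, hd, rfl⟩ : ∃ d, 0 < d ∧ p₂ = p₁ + d := ⟨p₂ - p₁, by omega, by omega⟩
  have h2' : PalPrefix f t₂ (m + p₁ + d) := by rwa [add_assoc]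
  obtain ⟨v, hv⟩ := hs.reflect h1 h2' (by omega)
  obtain rfl : d = p₁ := by
    have := hmiss v d hd (by omega) hv
    omega
  have c1 := AM.comp_eq_of_forall_lt (s := t₁) (t := s) (u := t₂) (v := t₁) hne fun q hq => by
    rw [← hs.shift h1 hq, h1.shift h2' (by omega)]
  have hφ : ∀ q < m + d, f (q + d) = t₁.letter (s.letter (f q)) := fun q hq => by
    rw [h1.shift h2' hq, c1]
  have c2 : ∀ a, u.letter (t₂.letter a) = t₁.letter (s.letter (t₁.letter (s.letter a))) := by
    obtain ⟨x, hx, y, hy, hxy⟩ := hne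
    have key : ∀ q < m, u.letter (t₂.letter (f q))
        = t₁.letter (s.letter (t₁.letter (s.letter (f q)))) := fun q hq => by
      rw [← h2.shift hu2 (by omega), ← add_assoc, hφ _ (by omega), hφ q (by omega)]
    exact eq_of_injective_of_eq_of_eq (u.letter_comp_injective t₂)
      ((t₁.letter_comp_injective s).comp (t₁.letter_comp_injective s)) hxy (key x hx) (key y hy)
  have hall : ∀ q < m + d + d + d, f (q + d) = t₁.letter (s.letter (f q)) := by
    intro q hq
    by_cases hqm : q < m + d
    · exact hφ q hqm
    · obtain ⟨r, rfl⟩ : ∃ r, q = r + (d + d) := ⟨q - (d + d), by omega⟩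
      rw [add_right_comm, h2.shift hu2 (by omega), hφ r (by omega), h2.shift hu2 (by omega),
        c2, c2]
  obtain ⟨v, hv⟩ := AM.exists_letter_eq_of_powers s t₁ t₂ u c1 c2
  have h3 : PalPrefix f v (m + (d + d + d)) := fun q r hqr => by
    rw [hu (q + d) r (by omega), hall q (by omega), hv]
  have := hmiss v (d + d + d) (by omega) (by omega) h3
  omega

theorem types_of_two_missed {s t₁ t₂ t u : AM} {m p₁ p₂ p L : ℕ} (hs : PalPrefix f s m)
    (h1 : PalPrefix f t₁ (m + p₁)) (h2 : PalPrefix f t₂ (m + p₂)) (hu : PalPrefix f u (m + L))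
    (hp1 : 0 < p₁) (hp12 : p₁ < p₂) (hp2L : p₂ < L)
    (hp0 : 0 < p) (hpm : p < m) (hpL : p < L) (hL : L < p + m) (ht : PalPrefix f t (m + p))
    (hmin : ∀ r, 0 < r → r < L → ¬ PalPrefix f u (m + r))
    (hmiss : ∀ t r, 0 < r → r < L → PalPrefix f t (m + r) → r = p₁ ∨ r = p₂) :
    ∃ i j k : Letter, i ≠ j ∧ j ≠ k ∧ i ≠ k ∧ s = .E i ∧ t₁ = .E j ∧ t₂ = .E k ∧ u = .E i := by
  have hrefl : ∀ t r, 0 < r → r < L → L < r + m → PalPrefix f t (m + r) →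
      L - r = p₁ ∨ L - r = p₂ := by
    intro t r h0 hrL hLr htr
    have hu' : PalPrefix f u (m + r + (L - r)) := by
      rwa [show m + r + (L - r) = m + L by omega]
    obtain ⟨v, hv⟩ := hs.reflect htr hu' (by omega)
    exact hmiss v (L - r) (by omega) (by omega) hv
  have ha := hmiss t p hp0 hpL ht
  have hb := hrefl t p hp0 hpL hL ht
  by_cases hsum : L = p₁ + p₂
  · subst hsum
    exact hs.types_of_symmetric h1 h2 hu hp1 hp12 (by omega) hmin hmiss
  · exfalso
    by_cases hmid : L = p₂ + p₂
    · subst hmid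
      exact hs.false_of_middle h1 h2 hu hp1 hp12 (by omega) hmin hmiss
    · have := hrefl t₂ p₂ (by omega) hp2L (by omega) h2
      omega

end PalPrefix

theorem AM.apply_length (t : AM) (v : Word) : (t.apply v).length = v.length := by
  simp [AM.apply]

theorem AM.apply_getElem (t : AM) (v : Word) (r : ℕ) (hr : r < (t.apply v).length)
    (h : v.length - 1 - r < v.length) : (t.apply v)[r] = t.letter (v[v.length - 1 - r]) := by
  simp [AM.apply]

/-- A prefix `v` of `W` is a `t`-palindrome exactly when the letter sequence of `W` says so. -/
theorem apply_eq_iff_palPrefix {v W : Word} (h : v <+: W) (t : AM) :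
    t.apply v = v ↔ PalPrefix (fun q => W.getD q 0) t v.length := by
  obtain ⟨x, rfl⟩ := h
  have hget : ∀ q (hq : q < v.length), (v ++ x).getD q 0 = v[q] := fun q hq => by
    rw [List.getD_append _ _ _ _ hq, List.getD_eq_getElem _ _ hq]
  constructor
  · intro ht q r hqr
    have hr : r < (t.apply v).length := by rw [t.apply_length]; omega
    have e := t.apply_getElem v r hr (by omega)
    simp only [show v.length - 1 - r = q by omega, ht] at e
    simp only [hget q (by omega), hget r (by omega), e]
  · intro hp
    refine List.ext_getElem (t.apply_length v) fun r hr hr' => ?_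
    have e := hp (v.length - 1 - r) r (by omega)
    simp only [hget _ hr', hget _ (show v.length - 1 - r < v.length by omega)] at e
    rw [t.apply_getElem v r hr (by omega), e]

theorem palPrefix_of_occurrence {u W : Word} {p : ℕ} (hu : u <+: W) (hp : p ≤ u.length)
    (h : OccursImageAt u W p) :
    ∃ t, PalPrefix (fun q => W.getD q 0) t (u.length + p) := by
  obtain ⟨hle, t, ht⟩ := h
  refine ⟨t, PalPrefix.of_occurrence hp fun q r hqr => ?_⟩
  have hr : r < (t.apply u).length := by rw [t.apply_length]; omega
  have e := t.apply_getElem u r hr (by omega)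
  simp only [← ht, List.getElem_take, List.getElem_drop, show u.length - 1 - r = q by omega] at e
  simp only [List.getD_eq_getElem _ _ (show p + r < W.length by omega),
    List.getD_eq_getElem _ _ (show q < W.length by omega), e,
    hu.getElem (show q < u.length by omega)]

/-- Corollary (two missed prefixes): if exactly two pseudopalindromic prefixes
`v₁`, `v₂` are missed between `w n` and `w (n+1)` and Assumption A holds, then
`w n`, `v₁`, `v₂`, `w (n+1)` are successively `E_i`-, `E_j`-, `E_k`-, and
`E_i`-palindromes for pairwise distinct `i, j, k`. -/
theorem types_when_two_prefixes_missed
    (Δ : ℕ → Letter) (Θ : ℕ → AM) (w : ℕ → Word)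
    (hw : DirectivePrefixes Δ Θ w) (n : ℕ)
    (hA : AssumptionA (w n) (w (n + 1)))
    (v₁ v₂ : Word) (hlen : v₁.length < v₂.length)
    (h₁ : MissedBetween (w n) (w (n + 1)) v₁)
    (h₂ : MissedBetween (w n) (w (n + 1)) v₂)
    (hexact : ∀ v : Word, MissedBetween (w n) (w (n + 1)) v → v = v₁ ∨ v = v₂) :
    ∃ i j k : Letter, i ≠ j ∧ j ≠ k ∧ i ≠ k ∧
      (AM.E i).apply (w n) = w n ∧ (AM.E j).apply v₁ = v₁ ∧
      (AM.E k).apply v₂ = v₂ ∧ (AM.E i).apply (w (n + 1)) = w (n + 1) := by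
  have hcl := hw.2 n
  obtain ⟨hpre, hpal, hshort⟩ := hcl
  have hwW : w n <+: w (n + 1) := (List.prefix_append _ _).trans hpre
  obtain ⟨p, hp0, hpL, hpm, hL, hocc⟩ := hA
  obtain ⟨s, hs⟩ : ∃ s : AM, s.apply (w n) = w n := by
    cases n with
    | zero => rw [hw.1] at hpm; simp at hpm
    | succ k => exact ⟨_, (hw.2 k).2.1⟩
  obtain ⟨hv1, ⟨t₁, ht1⟩, hl1, hl1'⟩ := h₁
  obtain ⟨hv2, ⟨t₂, ht2⟩, hl2, hl2'⟩ := h₂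
  obtain ⟨t, ht⟩ := palPrefix_of_occurrence hwW hpm.le hocc
  have hs' := (apply_eq_iff_palPrefix hwW s).1 hs
  have h1' := (apply_eq_iff_palPrefix hv1 t₁).1 ht1
  have h2' := (apply_eq_iff_palPrefix hv2 t₂).1 ht2
  have hu' := (apply_eq_iff_palPrefix (List.prefix_refl _) (Θ (n + 1))).1 hpal
  rw [show v₁.length = (w n).length + (v₁.length - (w n).length) by omega] at h1'
  rw [show v₂.length = (w n).length + (v₂.length - (w n).length) by omega] at h2'
  rw [show (w (n + 1)).length = (w n).length + ((w (n + 1)).length - (w n).length) by omega] at hu'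
  have htake : ∀ r, r < (w (n + 1)).length - (w n).length →
      ((w (n + 1)).take ((w n).length + r)).length = (w n).length + r := fun r hr => by
    rw [List.length_take]
    omega
  obtain ⟨i, j, k, hij, hjk, hik, rfl, rfl, rfl, hu⟩ :=
    hs'.types_of_two_missed h1' h2' hu' (by omega) (by omega) (by omega) hp0 hpm hpL (by omega) ht
      (by
        intro r hr0 hr hP
        have hlen := htake r hr
        rw [← hlen, ← apply_eq_iff_palPrefix (List.take_prefix _ _)] at hP
        have hδ : w n ++ [Δ (n + 1)] <+: (w (n + 1)).take ((w n).length + r) :=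
          List.prefix_of_prefix_length_le hpre (List.take_prefix _ _) (by
            rw [hlen, List.length_append, List.length_singleton]
            omega)
        have := hshort _ hδ hP
        omega)
      (by
        intro t' r hr0 hr hP
        have hlen := htake r hr
        rw [← hlen, ← apply_eq_iff_palPrefix (List.take_prefix _ _)] at hP
        have := hexact _ ⟨List.take_prefix _ _, ⟨t', hP⟩, by omega, by omega⟩
        rcases this with h | h
        · rw [h] at hlen
          omega
        · rw [h] at hlen
          omega)
  exact ⟨i, j, k, hij, hjk, hik, hs, ht1, ht2, hu ▸ hpal⟩
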